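/- arXiv:2605.01550 — 2 statements merged into one kernel-verified Lean document; each statement's English description precedes it below -/
import Mathlib

section
/- Let M = [a,b] ⊂ M₀ = [a₀,b₀] with a₀ < a < b < b₀, let f : M → M be a continuously differentiable hyperbolic map with f(a), f(b) ∈ (a,b), and set τ := (1/2)·min{f(a)−a, b−f(b)} > 0. Let F : M₀ → M₀ be a continuously differentiable map with F restricted to M equal to f, F({a₀,b₀}) ⊆ {a₀,b₀}, F'(x) ≠ 0 for all x ∈ [a₀,a] ∪ [b,b₀], and suppose there exist θ > 1, a₁ ∈ (a₀,a), b₁ ∈ (b,b₀) with F([a₀,a₁) ∪ (b₁,b₀]) ∩ [a+τ,b−τ] = ∅, F([a₁,a] ∪ [b,b₁]) ⊆ [a+τ,b−τ], and |F'| > θ on [a₀,a₁) ∪ (b₁,b₀]. Then F is hyperbolic: the set K₀ := {a₀,b₀} ∪ ⋃_{i≥0} F^{−i}(K(f)) is compact and satisfies F(K₀) ⊆ K₀, there exist C₀ > 0 and λ₀ > 1 with |(F^n)'(x)| ≥ C₀·λ₀^n for all x ∈ K₀ and n ≥ 1, F has only finitely many attracting periodic points, and for every x ∈ M₀ \ K₀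 the orbit (F^n(x))_{n≥1} converges to an attracting periodic orbit of F. -/
open Set Filter

/-- `x` is an attracting periodic point of period `p` for the interval map `g`
on `I` (derivatives taken within `I`). -/
def IsAttractingPeriodicPt (g : ℝ → ℝ) (I : Set ℝ) (x : ℝ) (p : ℕ) : Prop :=
  x ∈ I ∧ 0 < p ∧ g^[p] x = x ∧ |derivWithin (g^[p]) I x| < 1

/-- The orbit of `x` under `g` converges to an attracting periodic orbit. -/
def OrbitConvergesToAttracting (g : ℝ → ℝ) (I : Set ℝ) (x : ℝ) : Prop :=
  ∃ y p, IsAttractingPeriodicPt g I y p ∧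
    Tendsto (fun n => Metric.infDist (g^[n] x) {z | ∃ i : ℕ, z = g^[i] y})
      atTop (nhds 0)

/-- The interval map `g : I → I` is hyperbolic with hyperbolic set `K`:
`K` is compact and forward invariant, the derivatives of iterates expand
uniformly on `K`, there are only finitely many attracting periodic points, and
every orbit starting outside `K` converges to an attracting periodic orbit. -/
def IsHyperbolicOn (g : ℝ → ℝ) (I K : Set ℝ) : Prop :=
  IsCompact K ∧ K ⊆ I ∧ MapsTo g K K ∧
  (∃ c > (0:ℝ), ∃ θ₀ > (1:ℝ), ∀ x ∈ K, ∀ n : ℕ, 1 ≤ n →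
    c * θ₀ ^ n ≤ |derivWithin (g^[n]) I x|) ∧
  {x | ∃ p : ℕ, IsAttractingPeriodicPt g I x p}.Finite ∧
  ∀ x ∈ I \ K, OrbitConvergesToAttracting g I x

open Function Topology

section IntervalMap

variable {g : ℝ → ℝ} {I : Set ℝ}

lemma derivWithin_iterate_succ (hg : DifferentiableOn ℝ g I)
    (hm : MapsTo g I I) (n : ℕ) {x : ℝ} (hx : x ∈ I) :
    derivWithin (g^[n + 1]) I x = derivWithin (g^[n]) I (g x) * derivWithin g I x := by
  rw [iterate_succ]
  exact derivWithin_comp x (hg.iterate hm n (g x) (hm hx)) (hg x hx) hm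

lemma derivWithin_iterate_add (hg : DifferentiableOn ℝ g I)
    (hm : MapsTo g I I) (m n : ℕ) {x : ℝ} (hx : x ∈ I) :
    derivWithin (g^[m + n]) I x = derivWithin (g^[m]) I (g^[n] x) * derivWithin (g^[n]) I x := by
  rw [iterate_add]
  exact derivWithin_comp x (hg.iterate hm m _ (hm.iterate n hx)) (hg.iterate hm n x hx)
    (hm.iterate n)

lemma derivWithin_iterate_mul_of_isPeriodicPt (hI : UniqueDiffOn ℝ I)
    (hg : DifferentiableOn ℝ g I) (hm : MapsTo g I I) {p : ℕ} {x : ℝ} (hx : x ∈ I)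
    (hp : g^[p] x = x) (k : ℕ) :
    derivWithin (g^[p * k]) I x = derivWithin (g^[p]) I x ^ k := by
  induction k with
  | zero => simpa using derivWithin_id x I (hI x hx)
  | succ k ih => rw [mul_add_one, derivWithin_iterate_add hg hm _ _ hx, hp, ih, pow_succ]

lemma pow_le_abs_derivWithin_iterate (hI : UniqueDiffOn ℝ I)
    (hg : DifferentiableOn ℝ g I) (hm : MapsTo g I I) {θ : ℝ} (hθ : 0 ≤ θ) (n : ℕ) :
    ∀ x ∈ I, (∀ i : ℕ, θ ≤ |derivWithin g I (g^[i] x)|) →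
      θ ^ n ≤ |derivWithin (g^[n]) I x| := by
  induction n with
  | zero => intro x hx _; simp [derivWithin_id x I (hI x hx)]
  | succ n ih =>
    intro x hx h
    rw [derivWithin_iterate_succ hg hm n hx, abs_mul, pow_succ]
    exact mul_le_mul (ih (g x) (hm hx) fun i => h (i + 1)) (h 0) hθ (abs_nonneg _)

lemma not_isAttractingPeriodicPt_of_expanding (hI : UniqueDiffOn ℝ I)
    (hg : DifferentiableOn ℝ g I) (hm : MapsTo g I I) {c θ : ℝ} (hc : 0 < c) (hθ : 1 < θ)
    {x : ℝ} (hexp : ∀ n : ℕ, 1 ≤ n → c * θ ^ n ≤ |derivWithin (g^[n]) I x|) (p : ℕ) :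
    ¬ IsAttractingPeriodicPt g I x p := by
  rintro ⟨hx, hp, hper, hlt⟩
  obtain ⟨k, hk⟩ := pow_unbounded_of_one_lt (1 / c) hθ
  have h1 := hexp (p * (k + 1)) (Nat.mul_pos hp k.succ_pos)
  rw [derivWithin_iterate_mul_of_isPeriodicPt hI hg hm hx hper, abs_pow] at h1
  have h2 : |derivWithin (g^[p]) I x| ^ (k + 1) ≤ 1 := pow_le_one₀ (abs_nonneg _) hlt.le
  have h3 : θ ^ k ≤ θ ^ (p * (k + 1)) :=
    pow_le_pow_right₀ hθ.le (k.le_succ.trans (Nat.le_mul_of_pos_left _ hp))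
  rw [div_lt_iff₀ hc] at hk
  nlinarith

lemma orbit_finite_of_isPeriodicPt {p : ℕ} (hp : 0 < p) {y : ℝ} (hper : g^[p] y = y) :
    {z | ∃ i : ℕ, z = g^[i] y}.Finite := by
  refine ((Finset.range p).finite_toSet.image fun i => g^[i] y).subset ?_
  rintro _ ⟨i, rfl⟩
  have hper' : IsPeriodicPt g p y := hper
  exact ⟨i % p, by simpa using Nat.mod_lt i hp, hper'.iterate_mod_apply i⟩

/-- A hyperbolic set is backward invariant. -/
lemma IsHyperbolicOn.mem_of_iterate_mem {K : Set ℝ} (h : IsHyperbolicOn g I K)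
    (hI : UniqueDiffOn ℝ I) (hg : DifferentiableOn ℝ g I) (hm : MapsTo g I I)
    {x : ℝ} (hx : x ∈ I) {j : ℕ} (hj : g^[j] x ∈ K) : x ∈ K := by
  obtain ⟨hKc, -, hKm, ⟨c, hc, θ, hθ, hexp⟩, -, hconv⟩ := h
  by_contra hxK
  obtain ⟨y, p, hy, hlim⟩ := hconv x ⟨hx, hxK⟩
  obtain ⟨-, hp, hper, -⟩ := id hy
  have hmem : ∀ n, g^[n + j] x ∈ K := fun n => by
    rw [iterate_add_apply]; exact hKm.iterate n hj
  obtain ⟨k, hkK, φ, hφ, hφlim⟩ := hKc.tendsto_subseq hmem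
  have h1 : Tendsto (fun n => Metric.infDist (g^[φ n + j] x) {z | ∃ i : ℕ, z = g^[i] y})
      atTop (𝓝 0) := ((tendsto_add_atTop_iff_nat j).2 hlim).comp hφ.tendsto_atTop
  have h2 := ((Metric.continuous_infDist_pt {z | ∃ i : ℕ, z = g^[i] y}).tendsto k).comp hφlim
  have h3 := tendsto_nhds_unique h2 h1
  obtain ⟨i, hi⟩ : k ∈ {z | ∃ i : ℕ, z = g^[i] y} :=
    ((orbit_finite_of_isPeriodicPt hp hper).isClosed.mem_iff_infDist_zero ⟨y, 0, rfl⟩).2 h3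
  have hyK : y ∈ K := by
    have h4 : g^[p * i] y = y := IsPeriodicPt.mul_const (show IsPeriodicPt g p y from hper) i
    have h5 : p * i = (p * i - i) + i := (Nat.sub_add_cancel (Nat.le_mul_of_pos_left i hp)).symm
    rw [h5, iterate_add_apply, ← hi] at h4
    rw [← h4]
    exact hKm.iterate _ hkK
  exact not_isAttractingPeriodicPt_of_expanding hI hg hm hc hθ (hexp y hyK) p hy

lemma OrbitConvergesToAttracting.of_iterate {x : ℝ} (i : ℕ)
    (h : OrbitConvergesToAttracting g I (g^[i] x)) : OrbitConvergesToAttracting g I x := by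
  obtain ⟨y, p, hy, hlim⟩ := h
  refine ⟨y, p, hy, (tendsto_add_atTop_iff_nat i).1 ?_⟩
  simpa only [iterate_add_apply] using hlim

lemma derivWithin_iterate_subset {J : Set ℝ} (hJI : J ⊆ I) (hJ : UniqueDiffOn ℝ J)
    (hg : DifferentiableOn ℝ g I) (hm : MapsTo g I I) (n : ℕ) {x : ℝ} (hx : x ∈ J) :
    derivWithin (g^[n]) J x = derivWithin (g^[n]) I x :=
  derivWithin_subset hJI (hJ x hx) (hg.iterate hm n x (hJI hx))

lemma isAttractingPeriodicPt_subset_iff {J : Set ℝ} (hJI : J ⊆ I) (hJ : UniqueDiffOn ℝ J)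
    (hg : DifferentiableOn ℝ g I) (hm : MapsTo g I I) {p : ℕ} {x : ℝ} (hx : x ∈ J) :
    IsAttractingPeriodicPt g J x p ↔ IsAttractingPeriodicPt g I x p := by
  simp only [IsAttractingPeriodicPt, derivWithin_iterate_subset hJI hJ hg hm p hx, hx, hJI hx]

lemma OrbitConvergesToAttracting.mono {J : Set ℝ} (hJI : J ⊆ I) (hJ : UniqueDiffOn ℝ J)
    (hg : DifferentiableOn ℝ g I) (hm : MapsTo g I I) {x : ℝ}
    (h : OrbitConvergesToAttracting g J x) : OrbitConvergesToAttracting g I x := by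
  obtain ⟨y, p, hy, hlim⟩ := h
  exact ⟨y, p, (isAttractingPeriodicPt_subset_iff hJI hJ hg hm hy.1).1 hy, hlim⟩

lemma mul_abs_sub_le_of_le_abs_derivWithin {a b θ : ℝ} (hg : DifferentiableOn ℝ g (Icc a b))
    {u v : ℝ} (hu : u ∈ Icc a b) (hv : v ∈ Icc a b)
    (h : ∀ t ∈ uIcc u v, θ ≤ |derivWithin g (Icc a b) t|) :
    θ * |v - u| ≤ |g v - g u| := by
  wlog huv : u ≤ v generalizing u v
  · rw [abs_sub_comm v, abs_sub_comm (g v)]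
    exact this hv hu (by rwa [uIcc_comm]) (le_of_not_ge huv)
  rcases huv.eq_or_lt with rfl | huv
  · simp
  have hsub : Icc u v ⊆ Icc a b := Icc_subset_Icc hu.1 hv.2
  obtain ⟨t, ht, hslope⟩ := exists_hasDerivAt_eq_slope g (derivWithin g (Icc a b)) huv
    (hg.continuousOn.mono hsub) fun t ht =>
      (hg t (hsub (Ioo_subset_Icc_self ht))).hasDerivWithinAt.hasDerivAt
        (Icc_mem_nhds (hu.1.trans_lt ht.1) (ht.2.trans_le hv.2))
  have h1 := h t (by rw [uIcc_of_le huv.le]; exact Ioo_subset_Icc_self ht)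
  rw [hslope, abs_div, le_div_iff₀ (abs_pos.2 (sub_pos.2 huv).ne')] at h1
  exact h1

end IntervalMap

/-- If an orbit stays forever in a neighbourhood of the endpoints on which the map expands and
whose image misses an inner point, it is the orbit of an endpoint. -/
lemma mem_endpoints_of_forall_iterate_mem {a₀ b₀ a₁ b₁ m θ : ℝ} {F : ℝ → ℝ}
    (h01 : a₀ < a₁) (h10 : b₁ < b₀) (ham : a₁ < m) (hmb : m < b₁)
    (hF : DifferentiableOn ℝ F (Icc a₀ b₀)) (hFmaps : MapsTo F (Icc a₀ b₀) (Icc a₀ b₀))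
    (hFa₀ : F a₀ ∈ ({a₀, b₀} : Set ℝ)) (hFb₀ : F b₀ ∈ ({a₀, b₀} : Set ℝ)) (hθ : 1 < θ)
    (hout : ∀ x ∈ Ico a₀ a₁ ∪ Ioc b₁ b₀, F x ≠ m)
    (hexp : ∀ x ∈ Ico a₀ a₁ ∪ Ioc b₁ b₀, θ < |derivWithin F (Icc a₀ b₀) x|)
    {x : ℝ} (hx : ∀ i : ℕ, F^[i] x ∈ Ico a₀ a₁ ∪ Ioc b₁ b₀) :
    x ∈ ({a₀, b₀} : Set ℝ) := by
  have hOI : Ico a₀ a₁ ∪ Ioc b₁ b₀ ⊆ Icc a₀ b₀ := by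
    rintro z (hz | hz)
    · exact ⟨hz.1, by linarith [hz.2]⟩
    · exact ⟨by linarith [hz.1], hz.2⟩
  have hend : ∀ u ∈ ({a₀, b₀} : Set ℝ), F u ∈ ({a₀, b₀} : Set ℝ) ∧ u ∈ Icc a₀ b₀ := by
    rintro u (rfl | rfl)
    · exact ⟨hFa₀, by constructor <;> linarith⟩
    · exact ⟨hFb₀, by constructor <;> linarith⟩
  have hstep : ∀ u ∈ ({a₀, b₀} : Set ℝ), ∀ y, uIcc u y ⊆ Ico a₀ a₁ ∪ Ioc b₁ b₀ →
      F y ∈ Ico a₀ a₁ ∪ Ioc b₁ b₀ → uIcc (F u) (F y) ⊆ Ico a₀ a₁ ∪ Ioc b₁ b₀ := by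
    intro u hu y huy hFy
    have himg : m ∉ uIcc (F u) (F y) := fun hm => by
      obtain ⟨t, ht, htm⟩ := intermediate_value_uIcc (hF.continuousOn.mono (huy.trans hOI)) hm
      exact hout t (huy ht) htm
    rcases (hend u hu).1 with hFu | hFu <;> rw [hFu] at himg ⊢ <;> rcases hFy with hFy | hFy
    · rw [uIcc_of_le hFy.1]
      exact fun t ht => Or.inl ⟨ht.1, ht.2.trans_lt hFy.2⟩
    · rw [uIcc_of_le (by linarith [hFy.1])] at himg
      exact absurd ⟨by linarith, by linarith [hFy.1]⟩ himg
    · rw [uIcc_of_ge (by linarith [hFy.2])] at himg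
      exact absurd ⟨by linarith [hFy.2], by linarith⟩ himg
    · rw [uIcc_of_ge hFy.2]
      exact fun t ht => Or.inr ⟨hFy.1.trans_le ht.1, ht.2⟩
  obtain ⟨u, hu, hux⟩ : ∃ u ∈ ({a₀, b₀} : Set ℝ), uIcc u x ⊆ Ico a₀ a₁ ∪ Ioc b₁ b₀ := by
    have hx0 : x ∈ Ico a₀ a₁ ∪ Ioc b₁ b₀ := hx 0
    rcases hx0 with h | h
    · refine ⟨a₀, by simp, ?_⟩
      rw [uIcc_of_le h.1]
      exact fun t ht => Or.inl ⟨ht.1, ht.2.trans_lt h.2⟩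
    · refine ⟨b₀, by simp, ?_⟩
      rw [uIcc_of_ge h.2]
      exact fun t ht => Or.inr ⟨h.1.trans_le ht.1, ht.2⟩
  have key : ∀ n : ℕ, F^[n] u ∈ ({a₀, b₀} : Set ℝ) ∧
      uIcc (F^[n] u) (F^[n] x) ⊆ Ico a₀ a₁ ∪ Ioc b₁ b₀ ∧
      θ ^ n * |x - u| ≤ |F^[n] x - F^[n] u| := by
    intro n
    induction n with
    | zero => exact ⟨hu, hux, by simp⟩
    | succ n ih =>
      obtain ⟨ih1, ih2, ih3⟩ := ih
      have hx' := hx (n + 1)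
      rw [iterate_succ_apply'] at hx'
      rw [iterate_succ_apply', iterate_succ_apply']
      refine ⟨(hend _ ih1).1, hstep _ ih1 _ ih2 hx', ?_⟩
      have := mul_abs_sub_le_of_le_abs_derivWithin hF (hend _ ih1).2 (hOI (hx n))
        fun t ht => (hexp t (ih2 ht)).le
      refine le_trans ?_ this
      rw [pow_succ', mul_assoc]
      gcongr
  suffices x = u from this ▸ hu
  by_contra hne
  have hpos : 0 < |x - u| := abs_pos.2 (sub_ne_zero.2 hne)
  obtain ⟨n, hn⟩ := pow_unbounded_of_one_lt ((b₀ - a₀) / |x - u|) hθ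
  rw [div_lt_iff₀ hpos] at hn
  have h1 := (key n).2.2
  have h2 := abs_sub_le_of_le_of_le (hOI (hx n)).1 (hOI (hx n)).2
    (hend _ (key n).1).2.1 (hend _ (key n).1).2.2
  linarith

/-- **The endpoint-preserving extension of a hyperbolic interval map is
hyperbolic**, with hyperbolic set
`K₀ = {a₀,b₀} ∪ ⋃_{i ≥ 0} F⁻ⁱ(K) ∩ [a₀,b₀]`. -/
theorem extension_is_hyperbolic
    (a₀ a b b₀ : ℝ) (h0 : a₀ < a) (hab : a < b) (h1 : b < b₀)
    (F : ℝ → ℝ) (hF : ContDiffOn ℝ 1 F (Icc a₀ b₀))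
    (hFmaps : MapsTo F (Icc a₀ b₀) (Icc a₀ b₀))
    (hFM : MapsTo F (Icc a b) (Icc a b))
    (hFa : F a ∈ Ioo a b) (hFb : F b ∈ Ioo a b)
    (K : Set ℝ) (hhyp : IsHyperbolicOn F (Icc a b) K)
    (hFa₀ : F a₀ ∈ ({a₀, b₀} : Set ℝ)) (hFb₀ : F b₀ ∈ ({a₀, b₀} : Set ℝ))
    (hF' : ∀ x ∈ Icc a₀ a ∪ Icc b b₀, derivWithin F (Icc a₀ b₀) x ≠ 0)
    (θ : ℝ) (hθ : 1 < θ)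
    (a₁ : ℝ) (ha₁ : a₁ ∈ Ioo a₀ a) (b₁ : ℝ) (hb₁ : b₁ ∈ Ioo b b₀)
    (hout : ∀ x ∈ Ico a₀ a₁ ∪ Ioc b₁ b₀,
      F x ∉ Icc (a + min (F a - a) (b - F b) / 2) (b - min (F a - a) (b - F b) / 2))
    (hin : ∀ x ∈ Icc a₁ a ∪ Icc b b₁,
      F x ∈ Icc (a + min (F a - a) (b - F b) / 2) (b - min (F a - a) (b - F b) / 2))
    (hexp : ∀ x ∈ Ico a₀ a₁ ∪ Ioc b₁ b₀, θ < |derivWithin F (Icc a₀ b₀) x|) :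
    IsHyperbolicOn F (Icc a₀ b₀)
      ({a₀, b₀} ∪ {x | x ∈ Icc a₀ b₀ ∧ ∃ i : ℕ, F^[i] x ∈ K}) := by
  obtain ⟨hKc, hKM, hKm, ⟨c, hc, θ₀, hθ₀, hKexp⟩, hfin, hconv⟩ := id hhyp
  set τ := min (F a - a) (b - F b) / 2
  have hτ0 : 0 < τ := half_pos (lt_min (by linarith [hFa.1]) (by linarith [hFb.2]))
  have hFaτ := hin a (Or.inl ⟨ha₁.2.le, le_rfl⟩)
  have hMI : Icc a b ⊆ Icc a₀ b₀ := Icc_subset_Icc h0.le h1.le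
  have hI : UniqueDiffOn ℝ (Icc a₀ b₀) := uniqueDiffOn_Icc (by linarith)
  have hM : UniqueDiffOn ℝ (Icc a b) := uniqueDiffOn_Icc hab
  have hd : DifferentiableOn ℝ F (Icc a₀ b₀) := hF.differentiableOn one_ne_zero
  have hback : ∀ {x : ℝ}, x ∈ Icc a b → ∀ {j : ℕ}, F^[j] x ∈ K → x ∈ K :=
    fun hx _ hj => hhyp.mem_of_iterate_mem hM (hd.mono hMI) hFM hx hj
  set O : Set ℝ := Ico a₀ a₁ ∪ Ioc b₁ b₀
  set C : Set ℝ := Icc a₁ a ∪ Icc b b₁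
  have hcases : ∀ x ∈ Icc a₀ b₀, x ∈ O ∨ x ∈ C ∨ x ∈ Icc a b := by
    intro x hx
    rcases lt_or_ge x a₁ with h | h
    · exact Or.inl (Or.inl ⟨hx.1, h⟩)
    rcases lt_or_ge b₁ x with h' | h'
    · exact Or.inl (Or.inr ⟨h', hx.2⟩)
    rcases le_total x a with h2 | h2
    · exact Or.inr (Or.inl (Or.inl ⟨h, h2⟩))
    rcases le_total b x with h3 | h3
    · exact Or.inr (Or.inl (Or.inr ⟨h3, h'⟩))
    · exact Or.inr (Or.inr ⟨h2, h3⟩)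
  have hCM : ∀ x ∈ C, F x ∈ Icc a b := fun x hx =>
    ⟨by linarith [(hin x hx).1], by linarith [(hin x hx).2]⟩
  have hnotO : ∀ x ∈ Icc a₀ b₀, x ∉ O → F x ∈ Icc a b := fun x hx hxO =>
    ((hcases x hx).resolve_left hxO).elim (hCM x) fun h => hFM h
  have hstay : ∀ {x : ℝ}, (∀ i : ℕ, F^[i] x ∈ O) → x ∈ ({a₀, b₀} : Set ℝ) := fun hx =>
    mem_endpoints_of_forall_iterate_mem (m := a + τ) ha₁.1 hb₁.2 (by linarith [ha₁.2])
      (by linarith [hFaτ.1, hFaτ.2, hb₁.1]) hd hFmaps hFa₀ hFb₀ hθ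
      (fun x hx h => hout x hx ⟨h.ge, h.le.trans (hFaτ.1.trans hFaτ.2)⟩) hexp hx
  have hend : MapsTo F ({a₀, b₀} : Set ℝ) {a₀, b₀} := by
    rintro u (rfl | rfl)
    exacts [hFa₀, hFb₀]
  have hendI : ({a₀, b₀} : Set ℝ) ⊆ Icc a₀ b₀ := by
    rintro u (rfl | rfl) <;> constructor <;> linarith
  have hendM : ∀ u ∈ ({a₀, b₀} : Set ℝ), u ∉ Icc a b := by
    rintro u (rfl | rfl) hu <;> linarith [hu.1, hu.2]
  set K₀ : Set ℝ := {a₀, b₀} ∪ {x | x ∈ Icc a₀ b₀ ∧ ∃ i : ℕ, F^[i] x ∈ K}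
  have hK₀I : K₀ ⊆ Icc a₀ b₀ := union_subset hendI fun x hx => hx.1
  have hK₀M : ∀ x ∈ K₀, x ∈ Icc a b → x ∈ K := by
    rintro x (hx | ⟨-, i, hi⟩) hxM
    · exact absurd hxM (hendM x hx)
    · exact hback hxM hi
  have hK₀m : MapsTo F K₀ K₀ := by
    rintro x (hx | ⟨hxI, i, hi⟩)
    · exact Or.inl (hend hx)
    · refine Or.inr ⟨hFmaps hxI, i, ?_⟩
      rw [← iterate_succ_apply, iterate_succ_apply']
      exact hKm hi
  have henter : ∀ x ∈ Icc a₀ b₀ \ K₀, ∃ i : ℕ, F^[i] x ∈ Ioo a b \ K := by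
    rintro x ⟨hxI, hxK⟩
    have hnK : ∀ i, F^[i] x ∉ K := fun i hi => hxK (Or.inr ⟨hxI, i, hi⟩)
    suffices ∃ i : ℕ, F^[i] x ∈ Ioo a b from this.imp fun i hi => ⟨hi, hnK i⟩
    obtain ⟨i, hi⟩ : ∃ i : ℕ, F^[i] x ∉ O := by
      by_contra! h
      exact hxK (Or.inl (hstay h))
    have h2 := hnotO _ (hFmaps.iterate i hxI) hi
    rw [← iterate_succ_apply' F] at h2
    rcases h2.1.eq_or_lt with h3 | h3
    · exact ⟨i + 2, by rw [iterate_succ_apply', ← h3]; exact hFa⟩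
    rcases h2.2.eq_or_lt with h4 | h4
    · exact ⟨i + 2, by rw [iterate_succ_apply', h4]; exact hFb⟩
    · exact ⟨i + 1, h3, h4⟩
  have hescape : ∀ x ∈ K₀, ∀ i : ℕ, F^[i] x ∉ Ioo a b \ K := fun x hx i hi =>
    hi.2 (hK₀M _ (hK₀m.iterate i hx) (Ioo_subset_Icc_self hi.1))
  refine ⟨isCompact_Icc.of_isClosed_subset ?_ hK₀I, hK₀I, hK₀m, ?_, ?_, ?_⟩
  · refine isClosed_of_closure_subset fun x hx => ?_
    have hxI : x ∈ Icc a₀ b₀ := closure_minimal hK₀I isClosed_Icc hx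
    by_contra hxK
    obtain ⟨i, hi⟩ := henter x ⟨hxI, hxK⟩
    have hev : ∀ᶠ y in 𝓝[Icc a₀ b₀] x, F^[i] y ∈ Ioo a b \ K :=
      (hd.continuousOn.iterate hFmaps i x hxI).eventually
        ((isOpen_Ioo.sdiff hKc.isClosed).mem_nhds hi)
    obtain ⟨y, hyK, hy⟩ := ((mem_closure_iff_frequently.1 hx).and_eventually
      (eventually_nhdsWithin_iff.1 hev)).exists
    exact hescape y hyK i (hy (hK₀I hyK))
  · have hCI : C ⊆ Icc a₀ b₀ := union_subset
      (Icc_subset_Icc ha₁.1.le (by linarith)) (Icc_subset_Icc (by linarith) hb₁.2.le)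
    have hCne : C.Nonempty := ⟨a, Or.inl ⟨ha₁.2.le, le_rfl⟩⟩
    obtain ⟨t, ht, htmin⟩ := (isCompact_Icc.union isCompact_Icc : IsCompact C).exists_isMinOn hCne
      ((hF.continuousOn_derivWithin hI le_rfl).mono hCI).abs
    set d := min 1 |derivWithin F (Icc a₀ b₀) t|
    have hd0 : 0 < d := lt_min one_pos (abs_pos.2 (hF' t
      (ht.imp (fun h => ⟨ha₁.1.le.trans h.1, h.2⟩) fun h => ⟨h.1, h.2.trans hb₁.2.le⟩)))
    have hd1 : d ≤ 1 := min_le_left _ _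
    have hdC : ∀ x ∈ C, d ≤ |derivWithin F (Icc a₀ b₀) x| := fun x hx =>
      (min_le_right _ _).trans (htmin hx)
    set l := min θ θ₀
    have hl1 : 1 < l := lt_min hθ hθ₀
    have hl0 : 0 < l := one_pos.trans hl1
    set c' := min c 1
    have hc'0 : 0 < c' := lt_min hc one_pos
    have hc'1 : c' ≤ 1 := min_le_right _ _
    have hdl : d / l ≤ 1 := (div_le_one hl0).2 (hd1.trans hl1.le)
    have hC0 : c' * (d / l) ≤ c' := mul_le_of_le_one_right hc'0.le hdl
    have hone : ∀ x ∈ Icc a₀ b₀, |derivWithin (F^[0]) (Icc a₀ b₀) x| = 1 := fun x hx => by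
      simp [derivWithin_id x _ (hI x hx)]
    have hA : ∀ x ∈ K, ∀ n : ℕ, c' * l ^ n ≤ |derivWithin (F^[n]) (Icc a₀ b₀) x| := by
      intro x hx n
      rcases n.eq_zero_or_pos with rfl | hn
      · rw [hone x (hMI (hKM hx)), pow_zero, mul_one]
        exact hc'1
      · rw [← derivWithin_iterate_subset hMI hM hd hFmaps n (hKM hx)]
        refine le_trans ?_ (hKexp x hx n hn)
        gcongr
        · exact min_le_left _ _
        · exact min_le_right _ _
    have hB : ∀ n : ℕ, ∀ x ∈ K₀,
        c' * (d / l) * l ^ n ≤ |derivWithin (F^[n]) (Icc a₀ b₀) x| := by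
      intro n
      induction n with
      | zero =>
        intro x hx
        rw [hone x (hK₀I hx), pow_zero, mul_one]
        exact hC0.trans hc'1
      | succ n ih =>
        intro x hx
        rcases hcases x (hK₀I hx) with h | h | h
        · rw [derivWithin_iterate_succ hd hFmaps n (hK₀I hx), abs_mul, pow_succ, ← mul_assoc]
          exact mul_le_mul (ih _ (hK₀m hx)) ((min_le_left _ _).trans (hexp x h).le) hl0.le
            (abs_nonneg _)
        · rw [derivWithin_iterate_succ hd hFmaps n (hK₀I hx), abs_mul]
          calc c' * (d / l) * l ^ (n + 1) = c' * l ^ n * d := by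
                rw [pow_succ]; field_simp
            _ ≤ _ := mul_le_mul (hA _ (hK₀M _ (hK₀m hx) (hCM x h)) n) (hdC x h) hd0.le
                (abs_nonneg _)
        · exact le_trans (by gcongr) (hA x (hK₀M x hx h) (n + 1))
    exact ⟨c' * (d / l), mul_pos hc'0 (div_pos hd0 hl0), l, hl1, fun x hx n _ => hB n x hx⟩
  · refine hfin.subset ?_
    rintro x ⟨p, hx⟩
    obtain ⟨hxI, hp, hper, hlt⟩ := id hx
    obtain ⟨i, hi⟩ : ∃ i : ℕ, F^[i] x ∉ O := by
      by_contra! h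
      have := pow_le_abs_derivWithin_iterate hI hd hFmaps (one_pos.trans hθ).le p x hxI
        fun i => (hexp _ (h i)).le
      linarith [one_le_pow₀ hθ.le (n := p)]
    have h2 := hnotO _ (hFmaps.iterate i hxI) hi
    rw [← iterate_succ_apply' F] at h2
    have hxM : x ∈ Icc a b := by
      have hper' : F^[p * (i + 1)] x = x :=
        IsPeriodicPt.mul_const (show IsPeriodicPt F p x from hper) (i + 1)
      rw [← Nat.sub_add_cancel (Nat.le_mul_of_pos_left (i + 1) hp), iterate_add_apply] at hper'
      rw [← hper']
      exact hFM.iterate _ h2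
    exact ⟨p, (isAttractingPeriodicPt_subset_iff hMI hM hd hFmaps hxM).2 hx⟩
  · intro x hx
    obtain ⟨i, hi⟩ := henter x hx
    exact .of_iterate i
      ((hconv _ ⟨Ioo_subset_Icc_self hi.1, hi.2⟩).mono hMI hM hd hFmaps)
end

section
/- Let a₀ < a < b < b₀ be real numbers and let G : [a₀,b₀] → [a₀,b₀] be a continuous map with G({a₀,b₀}) ⊆ {a₀,b₀} and G([a,b]) ⊆ [a,b], and suppose every G-invariant Borel probability measure on [a₀,b₀] is supported on [a,b] ∪ {a₀,b₀}. Let φ : [a₀,b₀] → ℝ be continuous with φ(a₀) < Q(G,φ) and φ(b₀) < Q(G,φ). Then every measure in M_max(G,φ) is supported on [a,b]. -/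
open MeasureTheory Set

/-- `μ` is a `G`-invariant Borel probability measure for the dynamical system
`G` restricted to `S` (the measure gives full mass to `S`). -/
def IsInvProbOn (G : ℝ → ℝ) (S : Set ℝ) (μ : Measure ℝ) : Prop :=
  IsProbabilityMeasure μ ∧ μ S = 1 ∧
    ∀ B : Set ℝ, MeasurableSet B → μ (G ⁻¹' B ∩ S) = μ B

/-- The maximum ergodic average `Q(G, φ)` of the system `G` restricted to `S`. -/
noncomputable def maxErgAvgOn (G : ℝ → ℝ) (S : Set ℝ) (φ : ℝ → ℝ) : ℝ :=
  sSup {r : ℝ | ∃ μ : Measure ℝ, IsInvProbOn G S μ ∧ r = ∫ x, φ x ∂μ}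

/-- The set of `(G, φ)`-maximizing measures of the system `G` restricted to `S`. -/
def maxMeasuresOn (G : ℝ → ℝ) (S : Set ℝ) (φ : ℝ → ℝ) : Set (Measure ℝ) :=
  {μ : Measure ℝ | IsInvProbOn G S μ ∧ ∫ x, φ x ∂μ = maxErgAvgOn G S φ}

namespace IsInvProbOn

variable {G : ℝ → ℝ} {S I E : Set ℝ} {μ : Measure ℝ} {φ : ℝ → ℝ}

theorem ae_mem (h : IsInvProbOn G S μ) (hS : MeasurableSet S) : ∀ᵐ x ∂μ, x ∈ S :=
  have := h.1
  (mem_ae_iff_prob_eq_one hS).2 h.2.1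

theorem integrable (h : IsInvProbOn G S μ) (hS : IsCompact S) (hφ : ContinuousOn φ S) :
    Integrable φ μ := by
  have := h.1
  have hint := hφ.integrableOn_compact (μ := μ) hS
  rwa [IntegrableOn, Measure.restrict_eq_self_of_ae_mem (h.ae_mem hS.measurableSet)] at hint

theorem integral_le_maxErgAvgOn (h : IsInvProbOn G S μ) (hS : IsCompact S)
    (hφ : ContinuousOn φ S) : ∫ x, φ x ∂μ ≤ maxErgAvgOn G S φ := by
  refine le_csSup ?_ ⟨μ, h, rfl⟩
  obtain ⟨C, hC⟩ := hS.bddAbove_image hφ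
  refine ⟨C, ?_⟩
  rintro _ ⟨ν, hν, rfl⟩
  have := hν.1
  calc ∫ x, φ x ∂ν ≤ ∫ _, C ∂ν := by
        refine integral_mono_ae (hν.integrable hS hφ) (integrable_const C) ?_
        filter_upwards [hν.ae_mem hS.measurableSet] with x hx using hC (mem_image_of_mem φ hx)
    _ = C := by simp

/-- Conditioning an invariant measure on one of two disjoint forward-invariant sets which
together carry it gives an invariant measure. -/
theorem cond (h : IsInvProbOn G S μ) (hI : MeasurableSet I) (hIS : I ⊆ S) (hIE : Disjoint I E)
    (hGI : MapsTo G I I) (hGE : MapsTo G E E) (hμ : ∀ᵐ x ∂μ, x ∈ I ∪ E) (hμI : μ I ≠ 0) :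
    IsInvProbOn G S (ProbabilityTheory.cond μ I) := by
  have := h.1
  refine ⟨ProbabilityTheory.cond_isProbabilityMeasure hμI, ?_, fun B hB ↦ ?_⟩
  · rw [ProbabilityTheory.cond_apply hI, inter_eq_self_of_subset_left hIS,
      ENNReal.inv_mul_cancel hμI (measure_ne_top μ I)]
  · rw [ProbabilityTheory.cond_apply hI, ProbabilityTheory.cond_apply hI,
      ← h.2.2 _ (hI.inter hB)]
    congr 1
    refine measure_congr (Filter.eventuallyEq_set.2 ?_)
    filter_upwards [hμ] with x hx
    rcases hx with hx | hx
    · simp only [mem_inter_iff, mem_preimage, hx, hGI hx, hIS hx, true_and, and_true]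
    · have h₁ : x ∉ I := disjoint_right.1 hIE hx
      have h₂ : G x ∉ I := disjoint_right.1 hIE (hGE hx)
      simp [h₁, h₂]

theorem setIntegral_le_maxErgAvgOn_mul (h : IsInvProbOn G S μ) (hS : IsCompact S)
    (hφ : ContinuousOn φ S) (hI : MeasurableSet I) (hIS : I ⊆ S) (hIE : Disjoint I E)
    (hGI : MapsTo G I I) (hGE : MapsTo G E E) (hμ : ∀ᵐ x ∂μ, x ∈ I ∪ E) :
    ∫ x in I, φ x ∂μ ≤ maxErgAvgOn G S φ * μ.real I := by
  have := h.1
  by_cases hμI : μ I = 0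
  · simp [Measure.restrict_eq_zero.2 hμI, measureReal_def, hμI]
  · have hle := (h.cond hI hIS hIE hGI hGE hμ hμI).integral_le_maxErgAvgOn hS hφ
    rw [ProbabilityTheory.cond, integral_smul_measure, ENNReal.toReal_inv, smul_eq_mul,
      inv_mul_le_iff₀ (ENNReal.toReal_pos hμI (measure_ne_top μ I))] at hle
    rwa [mul_comm]

end IsInvProbOn

/-- **Maximizing measures avoid the endpoints.** If every invariant measure is
supported on `[a,b] ∪ {a₀,b₀}` and the values of `φ` at `a₀, b₀` lie strictly
below the maximum ergodic average, then every maximizing measure is supported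
on `[a,b]`. -/
theorem maxMeasures_supported_on_core
    (a₀ a b b₀ : ℝ) (h0 : a₀ < a) (hab : a < b) (h1 : b < b₀)
    (G : ℝ → ℝ) (hGc : ContinuousOn G (Icc a₀ b₀))
    (hGmaps : MapsTo G (Icc a₀ b₀) (Icc a₀ b₀))
    (hGa₀ : G a₀ ∈ ({a₀, b₀} : Set ℝ)) (hGb₀ : G b₀ ∈ ({a₀, b₀} : Set ℝ))
    (hGM : MapsTo G (Icc a b) (Icc a b))
    (hsupp : ∀ μ : Measure ℝ, IsInvProbOn G (Icc a₀ b₀) μ → μ (Icc a b ∪ {a₀, b₀}) = 1)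
    (φ : ℝ → ℝ) (hφ : ContinuousOn φ (Icc a₀ b₀))
    (hφa : φ a₀ < maxErgAvgOn G (Icc a₀ b₀) φ)
    (hφb : φ b₀ < maxErgAvgOn G (Icc a₀ b₀) φ) :
    ∀ μ ∈ maxMeasuresOn G (Icc a₀ b₀) φ, μ (Icc a b) = 1 := by
  rintro μ ⟨hμ, hmax⟩
  have := hμ.1
  have hIE : Disjoint (Icc a b) {a₀, b₀} := by
    rw [disjoint_right]
    rintro x (rfl | rfl) hx
    · exact h0.not_ge hx.1
    · exact h1.not_ge hx.2
  have hGE : MapsTo G {a₀, b₀} {a₀, b₀} := by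
    rintro x (rfl | rfl) <;> assumption
  have hE : MeasurableSet ({a₀, b₀} : Set ℝ) := (toFinite _).measurableSet
  have hae : ∀ᵐ x ∂μ, x ∈ Icc a b ∪ {a₀, b₀} :=
    (mem_ae_iff_prob_eq_one (measurableSet_Icc.union hE)).2 (hsupp μ hμ)
  have hint := hμ.integrable isCompact_Icc hφ
  have hI := hμ.setIntegral_le_maxErgAvgOn_mul isCompact_Icc hφ measurableSet_Icc
    (Icc_subset_Icc h0.le h1.le) hIE hGM hGE hae
  have hEle : ∫ x in {a₀, b₀}, φ x ∂μ ≤ max (φ a₀) (φ b₀) * μ.real {a₀, b₀} := by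
    calc ∫ x in {a₀, b₀}, φ x ∂μ ≤ ∫ _ in {a₀, b₀}, max (φ a₀) (φ b₀) ∂μ := by
          refine setIntegral_mono_on hint.integrableOn (integrable_const _) hE ?_
          rintro x (rfl | rfl)
          · exact le_max_left _ _
          · exact le_max_right _ _
      _ = max (φ a₀) (φ b₀) * μ.real {a₀, b₀} := by
          rw [setIntegral_const, smul_eq_mul, mul_comm]
  have hsplit := setIntegral_union hIE hE hint.integrableOn hint.integrableOn
  rw [Measure.restrict_eq_self_of_ae_mem hae, hmax] at hsplit
  have hmass : μ.real (Icc a b) + μ.real {a₀, b₀} = 1 := by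
    rw [← measureReal_union hIE hE, measureReal_def, hsupp μ hμ, ENNReal.toReal_one]
  have hlt := max_lt hφa hφb
  have hzero : μ.real {a₀, b₀} = 0 := by
    refine le_antisymm (not_lt.1 fun hpos ↦ ?_) measureReal_nonneg
    have hstrict := mul_lt_mul_of_pos_right hlt hpos
    rw [eq_sub_of_add_eq hmass, mul_sub, mul_one] at hI
    linarith
  rw [hzero, add_zero, measureReal_def] at hmass
  exact (ENNReal.toReal_eq_one_iff _).1 hmass
end
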